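/- For each fixed ŷ ∈ [ŷ_min, 1/2], the function δ ↦ Γ̂₋(ŷ;δ) := ŷ·s₋(ŷ;δ) is strictly decreasing on (0, δ_max]. Moreover, for all δ ∈ (0, δ_max]: Γ̂₋(ŷ_min;δ) ∈ [2m·ŷ_min/5, m·ŷ_min] and Γ̂₋(1/2;δ) ∈ [m/5, m/2]. -/

import Mathlib

noncomputable section
open Real Set

namespace Secular

def U00 : ℝ := 0.762646
def U10 : ℝ := 0.547442
def U20 : ℝ := 0.237353
def mC : ℝ := (-4 + Real.sqrt 21) / 5
def rhoC : ℝ := 1.762157978551987e-18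
def muC : ℝ := 398600.44
def aM : ℝ := 384400
def aMin : ℝ := 6378.14
def aMax : ℝ := 30000
def Lmin : ℝ := Real.sqrt (muC * aMin)
def Lmax : ℝ := Real.sqrt (muC * aMax)
def deltaFun (L : ℝ) : ℝ := rhoC * L ^ 10 / (muC ^ 3 * aM ^ 3)
def deltaMax : ℝ := deltaFun Lmax
def rho0 : ℝ := muC ^ 4 * 1.08e-3 * 6378.14 ^ 2
def rho1 : ℝ := rhoC * rho0
def alphaCube (L : ℝ) : ℝ := L ^ 6 / (muC ^ 3 * aM ^ 3)

def aA (σ : ℝ) : ℝ := 1 - 16 * σ - 20 * σ ^ 2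
def bB (σ : ℝ) : ℝ := (2 * σ + 3) * Real.sqrt (3 - 4 * σ - 4 * σ ^ 2)
def cPl (σ : ℝ) : ℝ := U00 / 2 * aA σ + 5 * U10 / 3 * bB σ
def cMi (σ : ℝ) : ℝ := U00 / 2 * aA σ - 5 * U10 / 3 * bB σ
def Ap (σ δ : ℝ) : ℝ := aA σ + δ * cPl σ
def Am (σ δ : ℝ) : ℝ := aA σ + δ * cMi σ


/-- `a(s) = 5s² + 8s − 1`. -/
def aE (s : ℝ) : ℝ := 5 * s ^ 2 + 8 * s - 1
def bEp (s : ℝ) : ℝ :=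
  10 * U00 * s * (1 + s) + 20 * U10 * (3 + s) * s ^ 2 / (3 * Real.sqrt (3 - 2*s - s^2))
def bEm (s : ℝ) : ℝ :=
  10 * U00 * s * (1 + s) - 20 * U10 * (3 + s) * s ^ 2 / (3 * Real.sqrt (3 - 2*s - s^2))
def cEp (s : ℝ) : ℝ :=
  8 * U00 * (3*s - 1) + 20 * U10 * (3 + s) * (8*s - 12) / (3 * Real.sqrt (3 - 2*s - s^2))
def cEm (s : ℝ) : ℝ :=
  8 * U00 * (3*s - 1) - 20 * U10 * (3 + s) * (8*s - 12) / (3 * Real.sqrt (3 - 2*s - s^2))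
def Gp (s yh δ : ℝ) : ℝ := aE s + 2 * δ * (bEp s * yh ^ 3 + cEp s * yh ^ 5)
def Gm (s yh δ : ℝ) : ℝ := aE s + 2 * δ * (bEm s * yh ^ 3 + cEm s * yh ^ 5)

def yHatMin : ℝ := Real.sqrt (-(bEp mC) / cEp mC)

lemma mC_bounds : 0.1165 < mC ∧ mC < 0.1166 := by
  have h1 : (4.5825 : ℝ) < √21 := Real.lt_sqrt_of_sq_lt (by norm_num)
  have h2 : √21 < (4.583 : ℝ) := (Real.sqrt_lt' (by norm_num)).2 (by norm_num)
  unfold mC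
  constructor <;> linarith

lemma aE_mC : aE mC = 0 := by
  have h : √21 ^ 2 = (21 : ℝ) := Real.sq_sqrt (by norm_num)
  unfold aE mC
  linarith

lemma deltaMax_le : deltaMax ≤ 0.12 := by
  have h : Lmax ^ 10 = (muC * aMax) ^ 5 := by
    have h0 : Lmax ^ 2 = muC * aMax := Real.sq_sqrt (by norm_num [muC, aMax])
    rw [← h0]
    ring
  unfold deltaMax deltaFun
  rw [h]
  norm_num [rhoC, muC, aMax, aM]

/-- The algebraic factor `(3 + s) / √(3 - 2s - s²) = √((3 + s) / (1 - s))`. -/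
def wE (s : ℝ) : ℝ := (3 + s) / √(3 - 2 * s - s ^ 2)

section wE

variable {s t : ℝ}

lemma wE_pos (hs : 0 ≤ s) (hs' : s < 1) : 0 < wE s :=
  div_pos (by linarith) (Real.sqrt_pos.2 (by nlinarith))

lemma wE_sq (hs : 0 ≤ s) (hs' : s < 1) : wE s ^ 2 = (3 + s) / (1 - s) := by
  have h : 3 - 2 * s - s ^ 2 = (3 + s) * (1 - s) := by ring
  have h1 : 3 + s ≠ 0 := by linarith
  have h2 : 1 - s ≠ 0 := by linarith
  rw [wE, div_pow, Real.sq_sqrt (by nlinarith), h]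
  field_simp

lemma three_sub_mul_wE_sq (hs : 0 ≤ s) (hs' : s < 1) :
    ((3 - 2 * s) * wE s) ^ 2 = 27 + 4 * s ^ 3 / (1 - s) := by
  have h2 : 1 - s ≠ 0 := by linarith
  rw [mul_pow, wE_sq hs hs']
  field_simp
  ring

lemma three_sub_mul_wE_mono (hs : 0 ≤ s) (hst : s ≤ t) (ht : t < 1) :
    (3 - 2 * s) * wE s ≤ (3 - 2 * t) * wE t := by
  have hw := wE_pos (hs.trans hst) ht
  refine le_of_abs_le (abs_le_of_sq_le_sq ?_ (mul_nonneg (by linarith) hw.le))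
  rw [three_sub_mul_wE_sq hs (by linarith), three_sub_mul_wE_sq (hs.trans hst) ht]
  have : 0 < 1 - t := by linarith
  have : 0 ≤ t := hs.trans hst
  gcongr

lemma wE_bounds (hs : 0 ≤ s) (hs' : s ≤ 1 / 2) : 1.7 ≤ wE s ∧ wE s ≤ 2.7 := by
  have hw := wE_pos hs (by linarith)
  have h := wE_sq hs (by linarith)
  have h2 : 0 < 1 - s := by linarith
  rw [eq_div_iff h2.ne'] at h
  constructor <;> by_contra! hc <;> nlinarith

lemma wE_sub_le (hs : 0 ≤ s) (hst : s ≤ t) (ht : t ≤ 1 / 2) :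
    wE t - wE s ≤ 5 * (t - s) := by
  have hw := wE_bounds hs (hst.trans ht)
  have hw' := wE_bounds (hs.trans hst) ht
  have h2 : 0 < 1 - s := by linarith
  have h3 : 0 < 1 - t := by linarith
  have h : wE t ^ 2 - wE s ^ 2 ≤ 16 * (t - s) := by
    rw [wE_sq hs (by linarith), wE_sq (hs.trans hst) (by linarith),
      div_sub_div _ _ h3.ne' h2.ne', div_le_iff₀ (by positivity)]
    have : 1 / 4 ≤ (1 - t) * (1 - s) := by nlinarith
    nlinarith
  nlinarith

lemma bEp_eq (s : ℝ) : bEp s = 10 * U00 * s * (1 + s) + 20 / 3 * U10 * (s ^ 2 * wE s) := by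
  unfold bEp wE
  rw [mul_comm (3 : ℝ) (√_), ← div_div]
  ring

lemma bEm_eq (s : ℝ) : bEm s = 10 * U00 * s * (1 + s) - 20 / 3 * U10 * (s ^ 2 * wE s) := by
  unfold bEm wE
  rw [mul_comm (3 : ℝ) (√_), ← div_div]
  ring

lemma cEp_eq (s : ℝ) :
    cEp s = 8 * U00 * (3 * s - 1) - 80 / 3 * U10 * ((3 - 2 * s) * wE s) := by
  unfold cEp wE
  rw [mul_comm (3 : ℝ) (√_), ← div_div]
  ring

lemma cEm_eq (s : ℝ) :
    cEm s = 8 * U00 * (3 * s - 1) + 80 / 3 * U10 * ((3 - 2 * s) * wE s) := by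
  unfold cEm wE
  rw [mul_comm (3 : ℝ) (√_), ← div_div]
  ring

lemma bEm_nonneg (hs : 0 ≤ s) (hs' : s ≤ 1 / 2) : 0 ≤ bEm s := by
  obtain ⟨hw₀, hw⟩ := wE_bounds hs hs'
  have h : s ^ 2 * wE s ≤ s * (1 / 2 * 2.7) := by
    rw [sq, mul_assoc]
    gcongr
  rw [bEm_eq]
  unfold U00 U10
  nlinarith

lemma cEm_pos (hs : 0 ≤ s) (hs' : s ≤ 1 / 2) : 0 < cEm s := by
  obtain ⟨hw, -⟩ := wE_bounds hs hs'
  have h : 2 * 1.7 ≤ (3 - 2 * s) * wE s := by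
    gcongr <;> linarith
  rw [cEm_eq]
  unfold U00 U10
  linarith

lemma bEm_mono (hs : 0 ≤ s) (hst : s ≤ t) (ht : t ≤ 1 / 8) : bEm s ≤ bEm t := by
  have hw := wE_bounds (hs.trans hst) (by linarith)
  have hd := wE_sub_le hs hst (by linarith)
  have h1 : (t ^ 2 - s ^ 2) * wE t ≤ (t - s) * (1 / 4 * 2.7) := by
    have : t ^ 2 - s ^ 2 = (t - s) * (t + s) := by ring
    rw [this, mul_assoc]
    have : 0 ≤ t - s := by linarith
    gcongr
    · linarith
    · linarith
    · exact hw.2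
  have h2 : s ^ 2 * (wE t - wE s) ≤ 5 * (1 / 64) * (t - s) := by
    have : s ^ 2 ≤ 1 / 64 := by nlinarith
    nlinarith [sq_nonneg s]
  rw [bEm_eq, bEm_eq]
  unfold U00 U10
  nlinarith

lemma cEm_mono (hs : 0 ≤ s) (hst : s ≤ t) (ht : t < 1) : cEm s ≤ cEm t := by
  have h := three_sub_mul_wE_mono hs hst ht
  rw [cEm_eq, cEm_eq]
  unfold U00 U10
  linarith

end wE

section Gm

variable {s t y δ : ℝ}

lemma Gm_mono (hs : 0 ≤ s) (hst : s ≤ t) (ht : t ≤ 1 / 8) (hy : 0 ≤ y) (hδ : 0 ≤ δ) :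
    Gm s y δ ≤ Gm t y δ := by
  have hb := bEm_mono hs hst ht
  have hc := cEm_mono hs hst (by linarith)
  unfold Gm aE
  gcongr

lemma forcing_pos (hs : 0 ≤ s) (hs' : s ≤ 1 / 2) (hy : 0 < y) :
    0 < bEm s * y ^ 3 + cEm s * y ^ 5 := by
  have hb := bEm_nonneg hs hs'
  have hc := cEm_pos hs hs'
  positivity

lemma Gm_strictMono_delta {δ' : ℝ} (hs : 0 ≤ s) (hs' : s ≤ 1 / 2) (hy : 0 < y) (h : δ < δ') :
    Gm s y δ < Gm s y δ' := by
  have := forcing_pos hs hs' hy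
  unfold Gm
  gcongr

lemma lt_mC_of_Gm_eq_zero (hs : 0 ≤ s) (hs' : s ≤ 1 / 2) (hy : 0 < y) (hδ : 0 < δ)
    (h : Gm s y δ = 0) : s < mC := by
  by_contra! hc
  have hm := mC_bounds
  have h1 := Gm_strictMono_delta hs hs' hy hδ
  have h2 : aE mC ≤ aE s := by
    unfold aE
    have : 0 ≤ mC := by linarith
    gcongr
  have h3 : Gm s y 0 = aE s := by simp [Gm]
  linarith [aE_mC]

lemma Gm_neg (hs : 0 ≤ s) (hs' : s ≤ 2 * mC / 5) (hy : 0 < y) (hy' : y ≤ 1 / 2)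
    (hδ : 0 < δ) (hδ' : δ ≤ 0.12) : Gm s y δ < 0 := by
  have hm := mC_bounds
  have hs2 : s ≤ 0.04664 := by linarith
  have hw := wE_pos hs (by linarith)
  have hb : bEm s ≤ 0.4 := by
    have : 0 ≤ s ^ 2 * wE s := by positivity
    rw [bEm_eq]
    unfold U00 U10
    nlinarith
  have hc : cEm s ≤ 71 := by
    have h : (3 - 2 * s) * wE s ≤ 5.21 := by
      refine le_of_abs_le (abs_le_of_sq_le_sq ?_ (by norm_num))
      have h3 : s ^ 3 ≤ 0.04664 ^ 3 := by gcongr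
      have h4 : 4 * s ^ 3 / (1 - s) ≤ 0.1 := by
        rw [div_le_iff₀ (by linarith)]
        linarith
      rw [three_sub_mul_wE_sq hs (by linarith)]
      linarith
    rw [cEm_eq]
    unfold U00 U10
    linarith
  have hΦ : bEm s * y ^ 3 + cEm s * y ^ 5 ≤ 0.4 * (1 / 2) ^ 3 + 71 * (1 / 2) ^ 5 := by
    gcongr
  have hδΦ : δ * (bEm s * y ^ 3 + cEm s * y ^ 5)
      ≤ 0.12 * (0.4 * (1 / 2) ^ 3 + 71 * (1 / 2) ^ 5) := by
    have := forcing_pos hs (by linarith) hy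
    gcongr
  unfold Gm aE
  nlinarith

lemma Gm_zero_mem_Ioo (hs : 0 ≤ s) (hs' : s ≤ 1 / 2) (hy : 0 < y) (hy' : y ≤ 1 / 2)
    (hδ : 0 < δ) (hδ' : δ ≤ deltaMax) (h : Gm s y δ = 0) :
    s ∈ Ioo (2 * mC / 5) mC := by
  refine ⟨?_, lt_mC_of_Gm_eq_zero hs hs' hy hδ h⟩
  by_contra! hc
  exact (Gm_neg hs hc hy hy' hδ (hδ'.trans deltaMax_le)).ne h

end Gm

lemma yHatMin_bounds : 0 < yHatMin ∧ yHatMin ≤ 1 / 2 := by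
  have hm := mC_bounds
  have hw := wE_bounds (s := mC) (by linarith) (by linarith)
  have hb : 0 < bEp mC ∧ bEp mC ≤ 2 := by
    have h0 : 0 ≤ mC ^ 2 * wE mC := mul_nonneg (sq_nonneg _) (by linarith)
    have h1 : mC ^ 2 * wE mC ≤ 0.1166 ^ 2 * 2.7 := by
      have : 0 ≤ mC := by linarith
      gcongr <;> linarith
    rw [bEp_eq]
    unfold U00 U10
    constructor <;> nlinarith
  have hc : cEp mC ≤ -8 := by
    have h : 2 * 1.7 ≤ (3 - 2 * mC) * wE mC := by
      gcongr <;> linarith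
    rw [cEp_eq]
    unfold U00 U10
    linarith
  unfold yHatMin
  refine ⟨Real.sqrt_pos.2 (div_pos_of_neg_of_neg (by linarith) (by linarith)), ?_⟩
  refine Real.sqrt_le_iff.2 ⟨by norm_num, ?_⟩
  rw [div_le_iff_of_neg (by linarith)]
  linarith

/-- for fixed `ŷ ∈ [ŷ_min,1/2]`, `δ ↦ Γ̂₋(ŷ;δ) = ŷ·s₋(ŷ;δ)` is strictly decreasing
on `(0,δ_max]`, and the boundary values `Γ̂₋(ŷ_min;δ)`, `Γ̂₋(1/2;δ)` lie in the stated intervals.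
Here `s₋(ŷ;δ)` is the unique zero of `G₋(·,ŷ;δ)` in `[0,1/2]` (it lies in `(2m/5, m)`). -/
theorem stmt8 (sm : ℝ → ℝ → ℝ)
    (hsm : ∀ δ ∈ Set.Ioc (0:ℝ) deltaMax, ∀ yh ∈ Set.Icc yHatMin (1/2),
      sm yh δ ∈ Set.Icc (0:ℝ) (1/2) ∧ Gm (sm yh δ) yh δ = 0) :
    (∀ yh ∈ Set.Icc yHatMin (1/2),
      StrictAntiOn (fun δ => yh * sm yh δ) (Set.Ioc 0 deltaMax)) ∧
    (∀ δ ∈ Set.Ioc (0:ℝ) deltaMax,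
      yHatMin * sm yHatMin δ ∈ Set.Icc (2 * mC * yHatMin / 5) (mC * yHatMin) ∧
      (1/2) * sm (1/2) δ ∈ Set.Icc (mC / 5) (mC / 2)) := by
  obtain ⟨hy0, hy1⟩ := yHatMin_bounds
  have key : ∀ δ ∈ Ioc (0 : ℝ) deltaMax, ∀ y ∈ Icc yHatMin (1 / 2),
      sm y δ ∈ Ioo (2 * mC / 5) mC := by
    intro δ hδ y hy
    obtain ⟨hs, hG⟩ := hsm δ hδ y hy
    exact Gm_zero_mem_Ioo hs.1 hs.2 (hy0.trans_le hy.1) hy.2 hδ.1 hδ.2 hG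
  refine ⟨fun y hy δ₁ h₁ δ₂ h₂ h12 => ?_, fun δ hδ => ⟨?_, ?_⟩⟩
  · have hy' : 0 < y := hy0.trans_le hy.1
    refine mul_lt_mul_of_pos_left ?_ hy'
    by_contra! hc
    obtain ⟨hs₁, hG₁⟩ := hsm δ₁ h₁ y hy
    obtain ⟨hs₂, hG₂⟩ := hsm δ₂ h₂ y hy
    have hlt := Gm_strictMono_delta hs₂.1 hs₂.2 hy' h12
    have hle := Gm_mono hs₁.1 hc
      (by linarith [(key δ₂ h₂ y hy).2, mC_bounds.2]) hy'.le h₁.1.le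
    linarith
  · obtain ⟨h1, h2⟩ := key δ hδ yHatMin ⟨le_rfl, hy1⟩
    constructor <;> nlinarith
  · obtain ⟨h1, h2⟩ := key δ hδ (1 / 2) ⟨hy1, le_rfl⟩
    constructor <;> linarith

end Secular
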